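/- Let f ∈ Mould(m) with m ≥ 2 be vegetal, homogeneous of weight −m, with nice poles. Then (∂f)(x^{-1},…,x^{-1}) = d/dx (f(x^{-1},…,x^{-1})) in ℚ(x); that is, the substitution u_i ↦ 1/x intertwines the mould derivative ∂ with the derivative with respect to x. -/

import Mathlib

/-!
Formalization of results from "The anticyclic operad of moulds" (F. Chapoton).

`Mould n` is the field of rational functions in variables `u 1, …, u n` with
rational coefficients, realized as a subfield of the fraction field `K` of
`ℚ[X 0, X 1, X 2, …]`.  The variable `u 0 = X 0` is reserved as an auxiliary
variable (the parameter `t` or `λ`).  Substitution of rational functions for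
the variables is realized by the (partial, well-defined) function `msub`.
-/

noncomputable section
namespace MouldOperad

open MvPolynomial Finset

attribute [local instance] Classical.propDecidable
set_option synthInstance.maxHeartbeats 1000000

abbrev MPoly : Type := MvPolynomial ℕ ℚ
abbrev K : Type := FractionRing MPoly

/-- the variable `u i` (1-based; index `0` is auxiliary). -/
def u (i : ℕ) : K := algebraMap MPoly K (X i)

/-- `u_{i..j} = u_i + u_{i+1} + ⋯ + u_j`. -/
def usum (i j : ℕ) : K := ∑ k ∈ Finset.Icc i j, u k

/-- evaluation of polynomials, sending the variable `X k` to `v k`. -/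
def pev (v : ℕ → K) : MPoly →+* K :=
  eval₂Hom ((algebraMap MPoly K).comp (C : ℚ →+* MPoly)) v

/-- Substitution of the rational functions `v k` for the variables of `f ∈ K`
(the induced field homomorphism): it takes the canonical value whenever `f` has
a fraction representation whose denominator does not vanish under the
substitution (this value does not depend on the representation), and the junk
value `0` otherwise. -/
def msub (v : ℕ → K) (f : K) : K :=
  if h : ∃ w : K, ∃ p q : MPoly, q ≠ 0 ∧
      f = algebraMap MPoly K p / algebraMap MPoly K q ∧
      pev v q ≠ 0 ∧ w = pev v p / pev v q
  then h.choose else 0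

/-- the field `Mould n` of rational functions in `u 1, …, u n`. -/
def Mould (n : ℕ) : Subfield K :=
  Subfield.closure {x : K | ∃ i, 1 ≤ i ∧ i ≤ n ∧ x = u i}

/-- substitution used for `f` in `f ∘_i g`, where `g` has degree `n`:
`f(u_1, …, u_{i-1}, u_{i..i+n-1}, u_{i+n}, …, u_{m+n-1})`. -/
def compSubF (n i : ℕ) : ℕ → K := fun k =>
  if k < i then u k else if k = i then usum i (i + n - 1) else u (k + n - 1)

/-- substitution used for `g` in `f ∘_i g` : `g(u_i, …, u_{i+n-1})`. -/
def compSubG (i : ℕ) : ℕ → K := fun k => u (k + i - 1)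

/-- the composition `f ∘_i g`, where `g` has degree `n` (1-based index `i`). -/
def comp (n i : ℕ) (f g : K) : K :=
  usum i (i + n - 1) * msub (compSubF n i) f * msub (compSubG i) g

/-- the push `τ` on `Mould n`: `τ(f)(u_1,…,u_n) = f(-u_{1..n}, u_1, …, u_{n-1})`. -/
def push (n : ℕ) (f : K) : K :=
  msub (fun k => if k = 1 then -(usum 1 n) else if k ≤ n then u (k - 1) else u k) f

/-- a permutation of `Fin n` as a (1-based) permutation of `ℕ`. -/
def permExt (n : ℕ) (σ : Equiv.Perm (Fin n)) : ℕ → ℕ := fun k =>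
  if h : 1 ≤ k ∧ k ≤ n then ((σ ⟨k - 1, by omega⟩ : Fin n) : ℕ) + 1 else k

/-- `f ∈ Mould n` is alternal : for each `1 ≤ i ≤ n-1`, the sum of
`f(u_{σ(1)}, …, u_{σ(n)})` over the shuffles `σ ∈ Sh(i, n-i)` vanishes. -/
def IsAlternal (n : ℕ) (f : K) : Prop :=
  ∀ i : ℕ, 1 ≤ i → i ≤ n - 1 →
    ∑ σ ∈ Finset.univ.filter (fun σ : Equiv.Perm (Fin n) =>
        (∀ a b : Fin n, a < b → (b : ℕ) < i → σ a < σ b) ∧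
        (∀ a b : Fin n, a < b → i ≤ (a : ℕ) → σ a < σ b)),
      msub (fun k => u (permExt n σ k)) f = 0

/-- `f ∈ Mould n` is vegetal :
`u_1⋯u_n · Σ_{σ ∈ S_n} f(t·u_{σ(1)}, …, t·u_{σ(n)}) = n! · f(t,…,t)`,
where the auxiliary variable `t` is `u 0`. -/
def IsVegetal (n : ℕ) (f : K) : Prop :=
  (∏ k ∈ Finset.Icc 1 n, u k) *
      ∑ σ : Equiv.Perm (Fin n), msub (fun k => u 0 * u (permExt n σ k)) f =
    (n.factorial : K) * msub (fun _ => u 0) f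

/-- `f ∈ Mould n` is homogeneous of weight `d` : `f(λu_1,…,λu_n) = λ^d·f`,
where the auxiliary variable `λ` is `u 0`. -/
def IsHomogeneousOfWeight (n : ℕ) (d : ℤ) (f : K) : Prop :=
  msub (fun k => if 1 ≤ k ∧ k ≤ n then u 0 * u k else u k) f = u 0 ^ d * f

/-- shift substitution : `g(u_{m+1}, …, u_{m+n})`. -/
def shiftSub (m : ℕ) : ℕ → K := fun k => u (k + m)

/-- `f ≻ g` for `f ∈ Mould m`, `g ∈ Mould n`. -/
def dsucc (m n : ℕ) (f g : K) : K :=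
  f * msub (shiftSub m) g * usum (m + 1) (m + n) / usum 1 (m + n)

/-- `f ≺ g` for `f ∈ Mould m`, `g ∈ Mould n`. -/
def dprec (m n : ℕ) (f g : K) : K :=
  f * msub (shiftSub m) g * usum 1 m / usum 1 (m + n)

/-- `MU(f,g)` for `f ∈ Mould m`. -/
def MU (m : ℕ) (f g : K) : K := f * msub (shiftSub m) g

/-- `LIMU(f,g) = MU(f,g) - MU(g,f)` for `f ∈ Mould m`, `g ∈ Mould n`. -/
def LIMU (m n : ℕ) (f g : K) : K := MU m f g - MU n g f

/-- the pre-Lie product `f ↶ g` for `f ∈ Mould m`, `g ∈ Mould n`. -/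
def preLieCurve (m n : ℕ) (f g : K) : K :=
  f * msub (shiftSub m) g * usum (m + 1) (m + n) / usum 1 (m + n)
    - g * msub (shiftSub n) f * usum 1 n / usum 1 (m + n)

/-- the pre-Lie product `f ∘ g = Σ_{i=1}^m f ∘_i g`, `f ∈ Mould m`, `g ∈ Mould n`. -/
def preLieComp (m n : ℕ) (f g : K) : K := ∑ i ∈ Finset.Icc 1 m, comp n i f g

/-- `H_n = ∏_{1 ≤ i ≤ j ≤ n} u_{i..j}`. -/
def Hprod (n : ℕ) : K := ∏ i ∈ Finset.Icc 1 n, ∏ j ∈ Finset.Icc i n, usum i j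

/-- `x` is (the image of) a polynomial in `u_1, …, u_n`. -/
def IsPolyIn (n : ℕ) (x : K) : Prop :=
  ∃ p : MPoly, (∀ k ∈ p.vars, 1 ≤ k ∧ k ≤ n) ∧ x = algebraMap MPoly K p

/-- `f ∈ Mould n` has nice poles: it is a polynomial divided by a product of
powers of the linear forms `u_{i..j}`, `1 ≤ i ≤ j ≤ n`. -/
def HasNicePoles (n : ℕ) (f : K) : Prop :=
  ∃ (P : MPoly) (e : ℕ → ℕ → ℕ),
    (∀ k ∈ P.vars, 1 ≤ k ∧ k ≤ n) ∧
    f = algebraMap MPoly K P /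
        ∏ i ∈ Finset.Icc 1 n, ∏ j ∈ Finset.Icc i n, usum i j ^ e i j

/-- the Over product `f / Y`, `f ∈ Mould n`. -/
def overY (n : ℕ) (f : K) : K := f / usum 1 (n + 1)

/-- the Under product `Y \ f`, `f ∈ Mould n`. -/
def underY (n : ℕ) (f : K) : K := msub (fun k => u (k + 1)) f / usum 1 (n + 1)

/-- `ARIT(f,g) = f ∘ (g/Y) - f ∘ (Y\g)` for `f ∈ Mould m`, `g ∈ Mould n`. -/
def ARIT (m n : ℕ) (f g : K) : K :=
  preLieComp m (n + 1) f (overY n g) - preLieComp m (n + 1) f (underY n g)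

/-- `ARI(f,g) = ARIT(f,g) - ARIT(g,f) + LIMU(f,g)`, `f ∈ Mould m`, `g ∈ Mould n`. -/
def ARI (m n : ℕ) (f g : K) : K := ARIT m n f g - ARIT n m g f + LIMU m n f g

/-- evaluation of polynomials into `RatFunc K` (rational functions in `t` over `K`). -/
def pevR (v : ℕ → RatFunc K) : MPoly →+* RatFunc K :=
  eval₂Hom ((RatFunc.C).comp ((algebraMap MPoly K).comp (C : ℚ →+* MPoly))) v

/-- substitution into `RatFunc K`. -/
def msubR (v : ℕ → RatFunc K) (f : K) : RatFunc K :=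
  if h : ∃ w : RatFunc K, ∃ p q : MPoly, q ≠ 0 ∧
      f = algebraMap MPoly K p / algebraMap MPoly K q ∧
      pevR v q ≠ 0 ∧ w = pevR v p / pevR v q
  then h.choose else 0

/-- residue at `t = 0`: the coefficient of `t⁻¹` in the Laurent expansion at `0`. -/
def res (r : RatFunc K) : K := (↑r : LaurentSeries K).coeff (-1)

/-- the mould derivative `∂f` for `f ∈ Mould m`:
`∂f(u_1,…,u_{m-1}) = Σ_{j=1}^m Res_{t=0} f(u_1,…,u_{j-1},t,u_j,…,u_{m-1})`,
where `f(u_1,…,u_{j-1},t,u_j,…,u_{m-1})` is viewed in `RatFunc K`. -/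
def mderiv (m : ℕ) (f : K) : K :=
  ∑ j ∈ Finset.Icc 1 m,
    res (msubR (fun k =>
      if k < j then RatFunc.C (u k)
      else if k = j then RatFunc.X
      else RatFunc.C (u (k - 1))) f)

/-- evaluation of polynomials into `ℚ(x)`, sending every variable to `1/x`. -/
def pevX : MPoly →+* RatFunc ℚ :=
  eval₂Hom (RatFunc.C : ℚ →+* RatFunc ℚ) (fun _ => (RatFunc.X)⁻¹)

/-- the substitution `u_i ↦ 1/x`, landing in `ℚ(x)`. -/
def evalx (f : K) : RatFunc ℚ :=
  if h : ∃ w : RatFunc ℚ, ∃ p q : MPoly, q ≠ 0 ∧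
      f = algebraMap MPoly K p / algebraMap MPoly K q ∧
      pevX q ≠ 0 ∧ w = pevX p / pevX q
  then h.choose else 0

/-- the derivative `d/dx` on `ℚ(x)`. -/
def rfDeriv (r : RatFunc ℚ) : RatFunc ℚ :=
  (algebraMap (Polynomial ℚ) (RatFunc ℚ) (Polynomial.derivative r.num) *
      algebraMap (Polynomial ℚ) (RatFunc ℚ) r.denom -
    algebraMap (Polynomial ℚ) (RatFunc ℚ) r.num *
      algebraMap (Polynomial ℚ) (RatFunc ℚ) (Polynomial.derivative r.denom)) /
    algebraMap (Polynomial ℚ) (RatFunc ℚ) r.denom ^ 2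

/-! ### Values of polynomials and fractions -/

theorem ringHom_aeval {A B : Type*} [CommRing A] [Algebra ℚ A] [CommRing B] [Algebra ℚ B]
    (ψ : A →+* B) (v : ℕ → A) (p : MPoly) : ψ (aeval v p) = aeval (fun k => ψ (v k)) p :=
  comp_aeval_apply v ψ.toRatAlgHom p

theorem ringHom_eq_aeval {A : Type*} [CommRing A] [Algebra ℚ A] (φ : MPoly →+* A) (p : MPoly) :
    φ p = aeval (fun k => φ (X k)) p := by
  simpa using ringHom_aeval φ X p

theorem aeval_congr_of_vars {A : Type*} [CommRing A] [Algebra ℚ A] {v w : ℕ → A} {p : MPoly}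
    (h : ∀ k ∈ p.vars, v k = w k) : aeval v p = aeval w p :=
  eval₂Hom_congr' rfl (fun k hk _ => h k hk) rfl

/-- The value at `v` of the fraction `P / D`. -/
def fracEval {F : Type*} [Field F] [Algebra ℚ F] (P D : MPoly) (v : ℕ → F) : F :=
  aeval v P / aeval v D

theorem map_fracEval {F E : Type*} [Field F] [Algebra ℚ F] [Field E] [Algebra ℚ E]
    (ψ : F →+* E) (P D : MPoly) (v : ℕ → F) :
    ψ (fracEval P D v) = fracEval P D (fun k => ψ (v k)) := by
  simp only [fracEval, map_div₀, ringHom_aeval]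

/-- The pairs `(p / q, φ p / φ q)` with `φ q ≠ 0`: the graph of the partially defined extension
of `φ` to the fraction field. -/
def specGraph {F : Type*} [Field F] [Algebra ℚ F] (φ : MPoly →+* F) : Subalgebra ℚ (K × F) where
  carrier := {x | ∃ p q : MPoly, φ q ≠ 0 ∧ x.1 * algebraMap MPoly K q = algebraMap MPoly K p ∧
    x.2 * φ q = φ p}
  mul_mem' := by
    rintro x y ⟨p, q, hq, h1, h2⟩ ⟨p', q', hq', h1', h2'⟩
    refine ⟨p * p', q * q', by simp [hq, hq'], ?_, ?_⟩
    · simp only [map_mul, ← h1, ← h1', Prod.fst_mul]; ring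
    · simp only [map_mul, ← h2, ← h2', Prod.snd_mul]; ring
  add_mem' := by
    rintro x y ⟨p, q, hq, h1, h2⟩ ⟨p', q', hq', h1', h2'⟩
    refine ⟨p * q' + p' * q, q * q', by simp [hq, hq'], ?_, ?_⟩
    · simp only [map_mul, map_add, ← h1, ← h1', Prod.fst_add]; ring
    · simp only [map_mul, map_add, ← h2, ← h2', Prod.snd_add]; ring
  algebraMap_mem' r := by
    refine ⟨C r, 1, by simp, ?_, ?_⟩
    · rw [map_one, mul_one]
      exact DFunLike.congr_fun
        (Subsingleton.elim (algebraMap ℚ K) ((algebraMap MPoly K).comp C)) r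
    · rw [map_one, mul_one]
      exact DFunLike.congr_fun (Subsingleton.elim (algebraMap ℚ F) (φ.comp C)) r

section specGraph

variable {F : Type*} [Field F] [Algebra ℚ F] {φ : MPoly →+* F}

theorem algebraMap_mem_specGraph (p : MPoly) : (algebraMap MPoly K p, φ p) ∈ specGraph φ :=
  ⟨p, 1, by simp, by simp, by simp⟩

theorem snd_eq_of_mem_specGraph {k : K} {p q : MPoly} {l : F} (h : (k, l) ∈ specGraph φ)
    (hk : k = algebraMap MPoly K p / algebraMap MPoly K q) (hq : φ q ≠ 0) : l = φ p / φ q := by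
  obtain ⟨p', q', hq', h1, h2⟩ := h
  have hq0 : algebraMap MPoly K q ≠ 0 := by
    intro h0
    rw [IsFractionRing.to_map_eq_zero_iff] at h0
    simp [h0] at hq
  dsimp only at h1 h2
  have key : p * q' = p' * q := by
    apply IsFractionRing.injective MPoly K
    rw [map_mul, map_mul, ← h1, hk]
    field_simp
  have := congrArg φ key
  rw [map_mul, map_mul, ← h2] at this
  rw [eq_div_iff hq]
  apply mul_right_cancel₀ hq'
  rw [this]; ring

theorem snd_eq_zero_of_mem_specGraph {l : F} (h : ((0 : K), l) ∈ specGraph φ) : l = 0 := by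
  simpa using snd_eq_of_mem_specGraph (p := 0) (q := 1) h (by simp) (by simp)

theorem inv_mem_specGraph {k : K} {l : F} (h : (k, l) ∈ specGraph φ) (hl : l ≠ 0) :
    (k⁻¹, l⁻¹) ∈ specGraph φ := by
  have hk : k ≠ 0 := by
    rintro rfl
    exact hl (snd_eq_zero_of_mem_specGraph h)
  obtain ⟨p, q, hq, h1, h2⟩ := h
  dsimp only at h1 h2
  refine ⟨q, p, by rw [← h2]; exact mul_ne_zero hl hq, ?_, ?_⟩
  · dsimp only; rw [← h1]; field_simp
  · dsimp only; rw [← h2]; field_simp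

theorem aeval_mem_specGraph {v : ℕ → K} {w : ℕ → F} (h : ∀ k, (v k, w k) ∈ specGraph φ)
    (p : MPoly) : (aeval v p, aeval w p) ∈ specGraph φ := by
  have h1 := ringHom_aeval (RingHom.fst K F) (fun k => (v k, w k)) p
  have h2 := ringHom_aeval (RingHom.snd K F) (fun k => (v k, w k)) p
  have h3 := (aeval (fun k => (⟨_, h k⟩ : specGraph φ)) p).2
  have h4 := ringHom_aeval (specGraph φ).val.toRingHom (fun k => (⟨_, h k⟩ : specGraph φ)) p
  have h5 : (aeval (fun k => (v k, w k)) p : K × F) = (aeval v p, aeval w p) := Prod.ext h1 h2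
  rw [← h5]
  exact h4 ▸ h3

theorem fracEval_mem_specGraph {v : ℕ → K} {w : ℕ → F} (h : ∀ k, (v k, w k) ∈ specGraph φ)
    (P : MPoly) {D : MPoly} (hD : aeval w D ≠ 0) :
    (fracEval P D v, fracEval P D w) ∈ specGraph φ := by
  simp only [fracEval, div_eq_mul_inv]
  exact mul_mem (aeval_mem_specGraph h P) (inv_mem_specGraph (aeval_mem_specGraph h D) hD)

theorem aeval_ne_zero_of_mem_specGraph {v : ℕ → K} {w : ℕ → F}
    (h : ∀ k, (v k, w k) ∈ specGraph φ) {D : MPoly} (hD : aeval w D ≠ 0) : aeval v D ≠ 0 := by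
  intro h0
  have := aeval_mem_specGraph h D
  rw [h0] at this
  exact hD (snd_eq_zero_of_mem_specGraph this)

end specGraph

/-! ### The substitutions of the statement -/

theorem ne_zero_of_map_ne_zero {F : Type*} [Field F] {φ : MPoly →+* F} {q : MPoly}
    (h : φ q ≠ 0) : q ≠ 0 := by
  rintro rfl
  simp at h

theorem map_div_unique {F : Type*} [Field F] [Algebra ℚ F] (φ : MPoly →+* F) {p q p' q' : MPoly}
    (h : algebraMap MPoly K p / algebraMap MPoly K q =
      algebraMap MPoly K p' / algebraMap MPoly K q') (hq : φ q ≠ 0) (hq' : φ q' ≠ 0) :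
    φ p / φ q = φ p' / φ q' :=
  snd_eq_of_mem_specGraph (k := algebraMap MPoly K p / algebraMap MPoly K q)
    (by
      simp only [div_eq_mul_inv]
      exact mul_mem (algebraMap_mem_specGraph p)
        (inv_mem_specGraph (algebraMap_mem_specGraph q) hq)) h hq'

theorem msub_div {v : ℕ → K} {p q : MPoly} (hq : aeval v q ≠ 0) :
    msub v (algebraMap MPoly K p / algebraMap MPoly K q) = fracEval p q v := by
  have hp : ∀ p, pev v p = aeval v p := fun p => by
    simpa [pev] using ringHom_eq_aeval (pev v) p
  simp only [fracEval, ← hp] at hq ⊢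
  have h : ∃ w : K, ∃ p' q' : MPoly, q' ≠ 0 ∧
      algebraMap MPoly K p / algebraMap MPoly K q =
        algebraMap MPoly K p' / algebraMap MPoly K q' ∧
      pev v q' ≠ 0 ∧ w = pev v p' / pev v q' :=
    ⟨_, p, q, ne_zero_of_map_ne_zero hq, rfl, hq, rfl⟩
  rw [msub, dif_pos h]
  obtain ⟨p', q', _, h1, h2, h3⟩ := h.choose_spec
  rw [h3]
  exact map_div_unique _ h1.symm h2 hq

theorem msubR_div {v : ℕ → RatFunc K} {p q : MPoly} (hq : aeval v q ≠ 0) :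
    msubR v (algebraMap MPoly K p / algebraMap MPoly K q) = fracEval p q v := by
  have hp : ∀ p, pevR v p = aeval v p := fun p => by
    simpa [pevR] using ringHom_eq_aeval (pevR v) p
  simp only [fracEval, ← hp] at hq ⊢
  have h : ∃ w : RatFunc K, ∃ p' q' : MPoly, q' ≠ 0 ∧
      algebraMap MPoly K p / algebraMap MPoly K q =
        algebraMap MPoly K p' / algebraMap MPoly K q' ∧
      pevR v q' ≠ 0 ∧ w = pevR v p' / pevR v q' :=
    ⟨_, p, q, ne_zero_of_map_ne_zero hq, rfl, hq, rfl⟩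
  rw [msubR, dif_pos h]
  obtain ⟨p', q', _, h1, h2, h3⟩ := h.choose_spec
  rw [h3]
  exact map_div_unique _ h1.symm h2 hq

theorem evalx_eq_of_mem_specGraph {k : K} {l : RatFunc ℚ} (h : (k, l) ∈ specGraph pevX) :
    evalx k = l := by
  obtain ⟨p, q, hq, h1, -⟩ := id h
  have hq0 : algebraMap MPoly K q ≠ 0 := by
    rw [Ne, IsFractionRing.to_map_eq_zero_iff]
    exact ne_zero_of_map_ne_zero hq
  have hx : ∃ w : RatFunc ℚ, ∃ p q : MPoly, q ≠ 0 ∧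
      k = algebraMap MPoly K p / algebraMap MPoly K q ∧
      pevX q ≠ 0 ∧ w = pevX p / pevX q :=
    ⟨_, p, q, ne_zero_of_map_ne_zero hq, by rw [eq_div_iff hq0]; exact h1, hq, rfl⟩
  rw [evalx, dif_pos hx]
  obtain ⟨p', q', _, h1, h2, h3⟩ := hx.choose_spec
  rw [h3]
  exact (snd_eq_of_mem_specGraph h h1 h2).symm

theorem u_mem_specGraph (k : ℕ) : (u k, (RatFunc.X : RatFunc ℚ)⁻¹) ∈ specGraph pevX := by
  simpa [u, pevX] using algebraMap_mem_specGraph (φ := pevX) (X k)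

/-- The vegetal identity can be specialized at `t = 1` and any point of any field. -/
theorem IsVegetal.specialize {m : ℕ} {P D : MPoly}
    (h : IsVegetal m (algebraMap MPoly K P / algebraMap MPoly K D))
    {F : Type*} [Field F] [Algebra ℚ F] (w : ℕ → F) (hw : w 0 = 1)
    (hσ : ∀ σ : Equiv.Perm (Fin m), aeval (fun k => w (permExt m σ k)) D ≠ 0)
    (h1 : aeval (fun _ => (1 : F)) D ≠ 0) :
    (∏ k ∈ Finset.Icc 1 m, w k) * ∑ σ : Equiv.Perm (Fin m),
        fracEval P D (fun k => w (permExt m σ k)) =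
      (m.factorial : F) * fracEval P D (fun _ => 1) := by
  let φ : MPoly →+* F := (aeval w : MPoly →ₐ[ℚ] F).toRingHom
  have hu (k : ℕ) : (u k, w k) ∈ specGraph φ := by
    simpa [u, φ] using algebraMap_mem_specGraph (φ := φ) (X k)
  have hu0 : (u 0, (1 : F)) ∈ specGraph φ := hw ▸ hu 0
  have huσ (σ : Equiv.Perm (Fin m)) (k : ℕ) :
      (u 0 * u (permExt m σ k), w (permExt m σ k)) ∈ specGraph φ := by
    simpa using mul_mem hu0 (hu (permExt m σ k))
  have hL := fun σ => fracEval_mem_specGraph (huσ σ) P (hσ σ)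
  have hR := fracEval_mem_specGraph (fun _ => hu0) P h1
  have hprod := prod_mem (S := specGraph φ) (t := Finset.Icc 1 m) fun k _ => hu k
  have hsum := sum_mem (S := specGraph φ) (t := Finset.univ) fun σ _ => hL σ
  have hfac := natCast_mem (specGraph φ) m.factorial
  have key := sub_mem (mul_mem hprod hsum) (mul_mem hfac hR)
  rw [IsVegetal, msub_div (aeval_ne_zero_of_mem_specGraph (fun _ => hu0) h1),
    Finset.sum_congr rfl
      fun σ _ => msub_div (aeval_ne_zero_of_mem_specGraph (huσ σ) (hσ σ))] at h
  rw [← sub_eq_zero]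
  apply snd_eq_zero_of_mem_specGraph (φ := φ)
  convert! key
  · simp only [Prod.fst_sub, Prod.fst_mul, Prod.fst_sum, Prod.fst_prod, Prod.fst_natCast, h,
      sub_self]
  · simp only [Prod.snd_sub, Prod.snd_mul, Prod.snd_sum, Prod.snd_prod, Prod.snd_natCast]

/-! ### Denominators and residues -/

/-- A product of powers of the linear forms `u_{i..j}`, as a polynomial. -/
def niceDen (m : ℕ) (e : ℕ → ℕ → ℕ) : MPoly :=
  ∏ i ∈ Finset.Icc 1 m, ∏ j ∈ Finset.Icc i m, (∑ k ∈ Finset.Icc i j, X k) ^ e i j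

theorem aeval_niceDen {A : Type*} [CommRing A] [Algebra ℚ A] (v : ℕ → A) (m : ℕ)
    (e : ℕ → ℕ → ℕ) : aeval v (niceDen m e) =
      ∏ i ∈ Finset.Icc 1 m, ∏ j ∈ Finset.Icc i m, (∑ k ∈ Finset.Icc i j, v k) ^ e i j := by
  simp [niceDen]

theorem algebraMap_niceDen (m : ℕ) (e : ℕ → ℕ → ℕ) : algebraMap MPoly K (niceDen m e) =
    ∏ i ∈ Finset.Icc 1 m, ∏ j ∈ Finset.Icc i m, usum i j ^ e i j := by
  simp [niceDen, usum, u]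

theorem aeval_niceDen_mem {A : Type*} [CommRing A] [Algebra ℚ A] (M : Submonoid A) {v : ℕ → A}
    {m : ℕ} (e : ℕ → ℕ → ℕ) (h : ∀ i j, 1 ≤ i → i ≤ j → ∑ k ∈ Finset.Icc i j, v k ∈ M) :
    aeval v (niceDen m e) ∈ M := by
  rw [aeval_niceDen]
  refine prod_mem fun i hi => prod_mem fun j hj => pow_mem (h i j ?_ ?_) _
  · exact (Finset.mem_Icc.1 hi).1
  · exact (Finset.mem_Icc.1 hj).1

theorem aeval_niceDen_congr {A : Type*} [CommRing A] [Algebra ℚ A] {v w : ℕ → A}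
    {m : ℕ} (e : ℕ → ℕ → ℕ) (h : ∀ k, 1 ≤ k → k ≤ m → v k = w k) :
    aeval v (niceDen m e) = aeval w (niceDen m e) := by
  simp only [aeval_niceDen]
  refine Finset.prod_congr rfl fun i hi => Finset.prod_congr rfl fun j hj => ?_
  rw [Finset.sum_congr rfl fun k hk => ?_]
  simp only [Finset.mem_Icc] at hi hj hk
  exact h k (by omega) (by omega)

theorem aeval_niceDen_const_ne_zero {F : Type*} [Field F] [Algebra ℚ F] {y : F} (hy : y ≠ 0)
    (m : ℕ) (e : ℕ → ℕ → ℕ) : aeval (fun _ => y) (niceDen m e) ≠ 0 := by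
  have : CharZero F := algebraRat.charZero F
  rw [← mem_nonZeroDivisors_iff_ne_zero]
  refine aeval_niceDen_mem _ e fun i j _ hij => ?_
  rw [mem_nonZeroDivisors_iff_ne_zero, Finset.sum_const, nsmul_eq_mul, Nat.card_Icc]
  exact mul_ne_zero (Nat.cast_ne_zero.2 (by omega)) hy

open scoped LaurentSeries PowerSeries in
/-- If the denominator is a power of `t` times a unit, then the residue of a fraction of power
series is compatible with all ring homomorphisms of the coefficients to fields. -/
theorem exists_residue {S : Type*} [CommRing S] [Algebra ℚ S] {w : ℕ → S⟦X⟧} (P : MPoly)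
    {D : MPoly} (hD : aeval w D ∈ Submonoid.powers (PowerSeries.X : S⟦X⟧) ⊔ IsUnit.submonoid _) :
    ∃ r : S, ∀ (E : Type) [Field E] [Algebra ℚ E⸨X⸩] (ψ : S →+* E),
      aeval (fun k => ((w k).map ψ : E⸨X⸩)) D ≠ 0 ∧
      (fracEval P D (fun k => ((w k).map ψ : E⸨X⸩))).coeff (-1) = ψ r := by
  obtain ⟨_, ⟨N, rfl⟩, _, ⟨U, rfl⟩, hNU⟩ := Submonoid.mem_sup.1 hD
  let g : S⟦X⟧ := aeval w P * (U⁻¹ : S⟦X⟧ˣ)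
  refine ⟨if N = 0 then 0 else PowerSeries.coeff (N - 1) g, fun E _ _ ψ => ?_⟩
  let ι : S⟦X⟧ →+* E⸨X⸩ := (HahnSeries.ofPowerSeries ℤ E).comp (PowerSeries.map ψ)
  have hι (p : MPoly) : aeval (fun k => ((w k).map ψ : E⸨X⸩)) p = ι (aeval w p) :=
    (ringHom_aeval ι w p).symm
  have hιX : ι (PowerSeries.X ^ N) = HahnSeries.single (N : ℤ) 1 := by
    simp [ι, HahnSeries.ofPowerSeries_X]
  have hX0 : ι (PowerSeries.X ^ N) ≠ 0 := by
    rw [hιX]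
    exact HahnSeries.single_ne_zero one_ne_zero
  have hU0 : ι U ≠ 0 := (U.isUnit.map ι).ne_zero
  have hfrac : fracEval P D (fun k => ((w k).map ψ : E⸨X⸩)) =
      HahnSeries.single (-(N : ℤ)) 1 * ι g := by
    have hs : (HahnSeries.single (-(N : ℤ)) 1 : E⸨X⸩) = (ι (PowerSeries.X ^ N))⁻¹ := by
      rw [hιX]
      apply eq_inv_of_mul_eq_one_left
      simp
    have hUi : ι ((U⁻¹ : S⟦X⟧ˣ) : S⟦X⟧) = (ι U)⁻¹ := by
      apply eq_inv_of_mul_eq_one_left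
      rw [← map_mul]
      simp
    rw [fracEval, hι, hι, ← hNU, map_mul, hs, map_mul, hUi]
    field_simp
  refine ⟨by rw [hι, ← hNU, map_mul]; exact mul_ne_zero hX0 hU0, ?_⟩
  rw [hfrac, HahnSeries.coeff_single_mul, one_mul]
  have hg : ι g = ((g.map ψ : E⟦X⟧) : E⸨X⸩) := rfl
  rw [hg, PowerSeries.coeff_coe]
  rcases N with _ | N
  · simp
  · have h : (-1 - -((N + 1 : ℕ) : ℤ)) = N := by push_cast; ring
    rw [h, if_neg (by omega), if_neg (by omega), PowerSeries.coeff_map]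
    simp

theorem isUnit_of_snd_ne_zero {F : Type*} [Field F] [Algebra ℚ F] {φ : MPoly →+* F}
    (x : specGraph φ) (hx : x.1.2 ≠ 0) : IsUnit x := by
  refine IsUnit.of_mul_eq_one ⟨_, inv_mem_specGraph x.2 hx⟩ (Subtype.ext (Prod.ext ?_ ?_))
  · refine mul_inv_cancel₀ fun h0 => hx (snd_eq_zero_of_mem_specGraph (φ := φ) ?_)
    rw [← h0]
    exact x.2
  · exact mul_inv_cancel₀ hx

open scoped RatFunc in
/-- The Laurent expansion at `0`. -/
def laurentHom (E : Type*) [Field E] : RatFunc E →+* LaurentSeries E := algebraMap _ _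

theorem laurentHom_X (E : Type*) [Field E] :
    laurentHom E RatFunc.X = HahnSeries.single 1 1 :=
  RatFunc.coe_X

theorem laurentHom_C {E : Type*} [Field E] (a : E) :
    laurentHom E (RatFunc.C a) = HahnSeries.C a := by
  rw [laurentHom, ← RatFunc.algebraMap_C]
  exact (RatFunc.coe_coe (Polynomial.C a)).symm.trans (by simp)

theorem res_eq_coeff_laurentHom (r : RatFunc K) : res r = (laurentHom K r).coeff (-1) := rfl

/-- The point `(x⁻¹, …, t, …, x⁻¹)`, with `t` at position `j`. -/
def polePoint (j : ℕ) : ℕ → LaurentSeries (RatFunc ℚ) := fun k =>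
  if k = j then HahnSeries.single 1 1 else HahnSeries.C RatFunc.X⁻¹

open scoped LaurentSeries PowerSeries in
/-- Taking the residue at `u_j = t` commutes with specializing the other variables to `x⁻¹`. -/
theorem residue_mem_specGraph (m : ℕ) (P : MPoly) (e : ℕ → ℕ → ℕ) (j : ℕ) :
    aeval (polePoint j) (niceDen m e) ≠ 0 ∧
    (res (msubR (fun k =>
      if k < j then RatFunc.C (u k)
      else if k = j then RatFunc.X
      else RatFunc.C (u (k - 1))) (algebraMap MPoly K P / algebraMap MPoly K (niceDen m e))),
      (fracEval P (niceDen m e) (polePoint j)).coeff (-1)) ∈ specGraph pevX := by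
  let s (k : ℕ) : specGraph pevX := ⟨_, u_mem_specGraph k⟩
  let w (k : ℕ) : (specGraph pevX)⟦X⟧ :=
    if k < j then PowerSeries.C (s k) else if k = j then PowerSeries.X
    else PowerSeries.C (s (k - 1))
  let fst : specGraph pevX →+* K := (RingHom.fst K _).comp (specGraph pevX).val.toRingHom
  let snd : specGraph pevX →+* RatFunc ℚ := (RingHom.snd K _).comp (specGraph pevX).val.toRingHom
  have hw : aeval w (niceDen m e) ∈
      Submonoid.powers (PowerSeries.X : (specGraph pevX)⟦X⟧) ⊔ IsUnit.submonoid _ := by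
    refine aeval_niceDen_mem _ e fun i l hi hl => ?_
    by_cases hj : i = j ∧ l = j
    · obtain ⟨rfl, rfl⟩ := hj
      refine Submonoid.mem_sup_left ⟨1, ?_⟩
      simp [w]
    · refine Submonoid.mem_sup_right (PowerSeries.isUnit_iff_constantCoeff.2
        (isUnit_of_snd_ne_zero _ ?_))
      have hsnd (k : ℕ) : snd (PowerSeries.constantCoeff (w k)) =
          if k = j then 0 else (RatFunc.X : RatFunc ℚ)⁻¹ := by
        rcases lt_trichotomy k j with h | h | h
        · simp [w, h, h.ne, snd, s]
        · simp [w, h]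
        · simp [w, h.not_gt, h.ne', snd, s]
      change snd (PowerSeries.constantCoeff (∑ k ∈ Finset.Icc i l, w k)) ≠ 0
      rw [map_sum, map_sum, Finset.sum_congr rfl fun k _ => hsnd k, Finset.sum_ite,
        Finset.sum_const_zero, zero_add, Finset.sum_const, nsmul_eq_mul]
      refine mul_ne_zero (Nat.cast_ne_zero.2 (Finset.card_ne_zero.2 ?_))
        (inv_ne_zero RatFunc.X_ne_zero)
      by_cases hij : i = j
      · exact ⟨l, by simp; omega⟩
      · exact ⟨i, by simp; omega⟩
  obtain ⟨r, hr⟩ := exists_residue P hw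
  have hw2 : (fun k => ((w k).map snd : (RatFunc ℚ)⸨X⸩)) = polePoint j := by
    funext k
    rcases lt_trichotomy k j with h | h | h
    · simp [w, h, h.ne, snd, s, polePoint]
    · simp [w, h, polePoint]
    · simp [w, h.not_gt, h.ne', snd, s, polePoint]
  have hw1 : (fun k => ((w k).map fst : K⸨X⸩)) = fun k => laurentHom K
      (if k < j then RatFunc.C (u k) else if k = j then RatFunc.X
        else RatFunc.C (u (k - 1))) := by
    funext k
    rcases lt_trichotomy k j with h | h | h
    · simp [w, h, fst, s, laurentHom_C]
    · simp [w, h, laurentHom_X]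
    · simp [w, h.not_gt, h.ne', fst, s, laurentHom_C]
  obtain ⟨h20, h2⟩ := hr _ snd
  obtain ⟨h10, h1⟩ := hr _ fst
  rw [hw2] at h20 h2
  rw [hw1] at h10 h1
  refine ⟨h20, ?_⟩
  rw [← ringHom_aeval (laurentHom K), map_ne_zero] at h10
  rw [msubR_div h10, res_eq_coeff_laurentHom, h2]
  rw [← map_fracEval (laurentHom K)] at h1
  rw [h1]
  exact r.2

theorem evalx_mderiv (m : ℕ) (P : MPoly) (e : ℕ → ℕ → ℕ) :
    evalx (mderiv m (algebraMap MPoly K P / algebraMap MPoly K (niceDen m e))) =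
      ∑ j ∈ Finset.Icc 1 m, (fracEval P (niceDen m e) (polePoint j)).coeff (-1) := by
  apply evalx_eq_of_mem_specGraph
  convert! sum_mem (S := specGraph pevX) (t := Finset.Icc 1 m)
    fun j _ => (residue_mem_specGraph m P e j).2
  · simp only [mderiv, Prod.fst_sum]
  · simp only [Prod.snd_sum]

/-! ### Symmetrization -/

theorem card_mul_sum_perm {m : ℕ} {R : Type*} [CommSemiring R] (g : Fin m → R) (a : Fin m) :
    (m : R) * ∑ σ : Equiv.Perm (Fin m), g (σ a) = (m.factorial : R) * ∑ i, g i := by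
  have hswap (b : Fin m) :
      ∑ σ : Equiv.Perm (Fin m), g (σ b) = ∑ σ : Equiv.Perm (Fin m), g (σ a) :=
    (Fintype.sum_equiv (Equiv.mulRight (Equiv.swap a b)) _ _ fun σ => by simp).symm
  calc (m : R) * ∑ σ : Equiv.Perm (Fin m), g (σ a)
      = ∑ b : Fin m, ∑ σ : Equiv.Perm (Fin m), g (σ b) := by simp [hswap]
    _ = ∑ σ : Equiv.Perm (Fin m), ∑ b, g (σ b) := Finset.sum_comm
    _ = ∑ _σ : Equiv.Perm (Fin m), ∑ b, g b :=
        Finset.sum_congr rfl fun σ _ => Equiv.sum_comp σ g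
    _ = (m.factorial : R) * ∑ i, g i := by simp [Fintype.card_perm]

theorem permExt_pos {m : ℕ} (σ : Equiv.Perm (Fin m)) {k : ℕ} (hk : 1 ≤ k) :
    1 ≤ permExt m σ k := by
  unfold permExt
  split_ifs <;> omega

theorem permExt_eq_one_iff {m : ℕ} (hm : 0 < m) (σ : Equiv.Perm (Fin m)) {k : ℕ} (hk : 1 ≤ k)
    (hkm : k ≤ m) : permExt m σ k = 1 ↔ k = (σ⁻¹ ⟨0, hm⟩ : Fin m) + 1 := by
  have hσ : σ⁻¹ ⟨0, hm⟩ = ⟨k - 1, by omega⟩ ↔ σ ⟨k - 1, by omega⟩ = ⟨0, hm⟩ := by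
    rw [Equiv.Perm.inv_eq_iff_eq, eq_comm]
  rw [permExt, dif_pos ⟨hk, hkm⟩, add_eq_right, ← Fin.ext_iff (b := ⟨0, hm⟩), ← hσ, Fin.ext_iff]
  simp only
  omega

theorem fracEval_niceDen_congr {F : Type*} [Field F] [Algebra ℚ F] {v w : ℕ → F} {m : ℕ}
    {P : MPoly} (hP : ∀ k ∈ P.vars, 1 ≤ k ∧ k ≤ m) (e : ℕ → ℕ → ℕ)
    (h : ∀ k, 1 ≤ k → k ≤ m → v k = w k) :
    fracEval P (niceDen m e) v = fracEval P (niceDen m e) w := by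
  rw [fracEval, fracEval, aeval_niceDen_congr e h,
    aeval_congr_of_vars fun k hk => h k (hP k hk).1 (hP k hk).2]

section vegetal

variable {m : ℕ} {P : MPoly} {e : ℕ → ℕ → ℕ}

/-- The value of a vegetal fraction on the diagonal. -/
theorem IsVegetal.fracEval_const (hP : ∀ k ∈ P.vars, 1 ≤ k ∧ k ≤ m)
    (h : IsVegetal m (algebraMap MPoly K P / algebraMap MPoly K (niceDen m e)))
    {F : Type*} [Field F] [Algebra ℚ F] {y : F} (hy : y ≠ 0) :
    y ^ m * fracEval P (niceDen m e) (fun _ => y) =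
      fracEval P (niceDen m e) (fun _ => (1 : F)) := by
  have : CharZero F := algebraRat.charZero F
  let w (k : ℕ) : F := if k = 0 then 1 else y
  have hw (σ : Equiv.Perm (Fin m)) (k : ℕ) (hk : 1 ≤ k) (_ : k ≤ m) : w (permExt m σ k) = y :=
    if_neg (Nat.one_le_iff_ne_zero.1 (permExt_pos σ hk))
  have key := h.specialize w rfl
    (fun σ => by
      rw [aeval_niceDen_congr e (hw σ)]
      exact aeval_niceDen_const_ne_zero hy m e)
    (aeval_niceDen_const_ne_zero one_ne_zero m e)
  have hprod : ∏ k ∈ Finset.Icc 1 m, w k = y ^ m := by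
    rw [Finset.prod_congr rfl fun k hk =>
      if_neg (Nat.one_le_iff_ne_zero.1 (Finset.mem_Icc.1 hk).1)]
    simp
  rw [hprod, Finset.sum_congr rfl fun σ _ => fracEval_niceDen_congr hP e (hw σ),
    Finset.sum_const, Finset.card_univ, Fintype.card_perm, Fintype.card_fin, nsmul_eq_mul] at key
  have hfac : (m.factorial : F) ≠ 0 := Nat.cast_ne_zero.2 (Nat.factorial_ne_zero m)
  apply mul_left_cancel₀ hfac
  rw [← key]
  ring

/-- The sum of the values of a vegetal fraction at all points with one coordinate `t` and all
others `y`. -/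
theorem IsVegetal.sum_fracEval_ite (hm : 0 < m) (hP : ∀ k ∈ P.vars, 1 ≤ k ∧ k ≤ m)
    (h : IsVegetal m (algebraMap MPoly K P / algebraMap MPoly K (niceDen m e)))
    {F : Type*} [Field F] [Algebra ℚ F] {t y : F}
    (hD : ∀ j, aeval (fun k => if k = j then t else y) (niceDen m e) ≠ 0) :
    t * (y ^ (m - 1) *
        ∑ j ∈ Finset.Icc 1 m, fracEval P (niceDen m e) (fun k => if k = j then t else y)) =
      (m : F) * fracEval P (niceDen m e) (fun _ => 1) := by
  have : CharZero F := algebraRat.charZero F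
  let w (k : ℕ) : F := if k = 0 then 1 else if k = 1 then t else y
  have hw (σ : Equiv.Perm (Fin m)) (k : ℕ) (hk : 1 ≤ k) (hkm : k ≤ m) :
      w (permExt m σ k) = if k = (σ⁻¹ ⟨0, hm⟩ : Fin m) + 1 then t else y := by
    simp only [w, if_neg (Nat.one_le_iff_ne_zero.1 (permExt_pos σ hk)),
      permExt_eq_one_iff hm σ hk hkm]
  have key := h.specialize w rfl
    (fun σ => by
      rw [aeval_niceDen_congr e (hw σ)]
      exact hD _)
    (aeval_niceDen_const_ne_zero one_ne_zero m e)
  have hprod : ∏ k ∈ Finset.Icc 1 m, w k = t * y ^ (m - 1) := by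
    rw [← Finset.mul_prod_Ioc_eq_prod_Icc hm]
    congr 1
    rw [Finset.prod_congr rfl fun k hk => ?_, Finset.prod_const, Nat.card_Ioc]
    simp only [Finset.mem_Ioc] at hk
    simp only [w]
    rw [if_neg (by omega), if_neg (by omega)]
  let g (j : ℕ) : F := fracEval P (niceDen m e) (fun k => if k = j then t else y)
  have hsum : (m : F) * ∑ σ : Equiv.Perm (Fin m),
        fracEval P (niceDen m e) (fun k => w (permExt m σ k)) =
      (m.factorial : F) * ∑ j ∈ Finset.Icc 1 m, g j := by
    rw [Finset.sum_congr rfl fun σ _ => fracEval_niceDen_congr hP e (hw σ)]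
    change (m : F) * ∑ σ : Equiv.Perm (Fin m), g ((σ⁻¹ ⟨0, hm⟩ : Fin m) + 1) = _
    have hinv : ∑ σ : Equiv.Perm (Fin m), g ((σ⁻¹ ⟨0, hm⟩ : Fin m) + 1) =
        ∑ σ : Equiv.Perm (Fin m), g ((σ ⟨0, hm⟩ : Fin m) + 1) :=
      Fintype.sum_equiv (Equiv.inv _) _ _ fun _ => rfl
    rw [hinv, card_mul_sum_perm fun i : Fin m => g (i + 1), Fin.sum_univ_eq_sum_range fun i => g (i + 1),
      Finset.range_eq_Ico, Finset.sum_Ico_add' g]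
    rfl
  have hfac : (m.factorial : F) ≠ 0 := Nat.cast_ne_zero.2 (Nat.factorial_ne_zero m)
  apply mul_left_cancel₀ hfac
  rw [hprod] at key
  linear_combination (m : F) * key - t * y ^ (m - 1) * hsum

end vegetal

theorem rfDeriv_C_mul_X_pow (c : ℚ) (n : ℕ) :
    rfDeriv (RatFunc.C c * RatFunc.X ^ n) = (n : RatFunc ℚ) * RatFunc.C c * RatFunc.X ^ (n - 1) := by
  have h : (RatFunc.C c * RatFunc.X ^ n : RatFunc ℚ) =
      algebraMap (Polynomial ℚ) (RatFunc ℚ) (Polynomial.C c * Polynomial.X ^ n) := by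
    simp [RatFunc.algebraMap_C, RatFunc.algebraMap_X]
  rw [rfDeriv, h, RatFunc.num_algebraMap, RatFunc.denom_algebraMap]
  simp [RatFunc.algebraMap_C, RatFunc.algebraMap_X, Polynomial.derivative_X_pow]
  ring

/-- for `f ∈ Mould m`, `m ≥ 2`, vegetal, homogeneous of weight
`-m`, with nice poles, one has `(∂f)(x⁻¹,…,x⁻¹) = d/dx (f(x⁻¹,…,x⁻¹))` in `ℚ(x)`. -/
theorem forgetful_mderiv (m : ℕ) (hm : 2 ≤ m)
    (f : K) (hf : f ∈ Mould m)
    (hfv : IsVegetal m f)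
    (hfh : IsHomogeneousOfWeight m (-(m : ℤ)) f)
    (hfp : HasNicePoles m f) :
    evalx (mderiv m f) = rfDeriv (evalx f) := by
  obtain ⟨P, e, hP, rfl⟩ := hfp
  rw [← algebraMap_niceDen] at hfv ⊢
  have hX : (RatFunc.X : RatFunc ℚ) ≠ 0 := RatFunc.X_ne_zero
  let c : ℚ := fracEval P (niceDen m e) (fun _ => 1)
  have hc {F : Type} [Field F] [Algebra ℚ F] (ψ : ℚ →+* F) :
      fracEval P (niceDen m e) (fun _ => (1 : F)) = ψ c := by
    rw [map_fracEval]
    simp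
  have hev : evalx (algebraMap MPoly K P / algebraMap MPoly K (niceDen m e)) =
      RatFunc.C c * RatFunc.X ^ m := by
    have hmem := fracEval_mem_specGraph u_mem_specGraph P
      (aeval_niceDen_const_ne_zero (inv_ne_zero hX) m e)
    have hu (p : MPoly) : aeval u p = algebraMap MPoly K p :=
      (ringHom_eq_aeval (algebraMap MPoly K) p).symm
    rw [fracEval, hu, hu] at hmem
    rw [evalx_eq_of_mem_specGraph hmem, ← hc, ← hfv.fracEval_const hP (inv_ne_zero hX),
      mul_right_comm, ← mul_pow, inv_mul_cancel₀ hX, one_pow, one_mul]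
  rw [hev, evalx_mderiv, rfDeriv_C_mul_X_pow]
  have h := hfv.sum_fracEval_ite (by omega) hP fun j => (residue_mem_specGraph m P e j).1
  rw [hc (HahnSeries.C.comp RatFunc.C), RingHom.comp_apply, ← map_natCast HahnSeries.C m,
    ← map_mul, ← map_pow] at h
  have h0 := congrArg (fun x => HahnSeries.coeff x 0) h
  simp only [HahnSeries.coeff_single_mul, HahnSeries.coeff_sum, HahnSeries.C_apply,
    HahnSeries.coeff_single_same, zero_sub, sub_zero, one_mul] at h0
  rw [← h0, mul_right_comm, ← mul_pow, inv_mul_cancel₀ hX, one_pow, one_mul]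
  rfl

end MouldOperad
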